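/- Assume ω is symmetric, m = 2n with n ≥ 1, and d_{k−1} = n. Let X be the set of isotropic partial flags of type d in V, and let SO(V,ω) = {g linear automorphism of V : ω(g(v),g(w)) = ω(v,w) for all v,w, and det g = 1} act on X via g·(V_p)_p = (g(V_p))_p. Then this action has exactly two orbits: there exist F₁, F₂ ∈ X not lying in the same SO(V,ω)-orbit such that every element of X lies in the orbit of F₁ or in the orbit of F₂. -/

import Mathlib

open Module Submodule

theorem aux_li {V : Type*} [AddCommGroup V] [Module ℂ V] {ι : Type*} [Fintype ι] [DecidableEq ι]
    (ω : V →ₗ[ℂ] V →ₗ[ℂ] ℂ) (b c : ι → V) (a : ι → ℂ) (ha : ∀ i, a i ≠ 0)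
    (h : ∀ i j, ω (b i) (c j) = if i = j then a j else 0) : LinearIndependent ℂ b := by
  rw [Fintype.linearIndependent_iff]
  intro g hg i
  have h1 := congrArg (fun x => ω x (c i)) hg
  simp [h] at h1
  exact h1.resolve_right (ha i)

/-- Complete an isotropic family to a hyperbolic basis. -/
theorem aux_hyp {V : Type*} [AddCommGroup V] [Module ℂ V] [FiniteDimensional ℂ V]
    (n : ℕ) (hn : 1 ≤ n) (hdimV : finrank ℂ V = 2 * n)
    (ω : V →ₗ[ℂ] V →ₗ[ℂ] ℂ)
    (hnd : ∀ v, (∀ w, ω v w = 0) → v = 0)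
    (hsym : ∀ v w, ω v w = ω w v)
    (e : Fin n → V) (he : LinearIndependent ℂ e) (hiso : ∀ i j, ω (e i) (e j) = 0) :
    ∃ b : Basis (Fin n ⊕ Fin n) ℂ V, (∀ i, b (Sum.inl i) = e i) ∧
      ∀ x y, ω (b x) (b y) = if x.swap = y then 1 else 0 := by
  have hsurj : Function.Surjective ω := by
    have hinj : Function.Injective ω := by
      rw [injective_iff_map_eq_zero]
      intro v hv
      exact hnd v (fun w => by rw [hv]; rfl)
    exact (LinearMap.injective_iff_surjective_of_finrank_eq_finrank
      (Subspace.dual_finrank_eq (K := ℂ) (V := V)).symm).1 hinj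
  have h1 : ∀ j : Fin n, ∃ f : V, ∀ i, ω f (e i) = if i = j then 1 else 0 := by
    intro j
    obtain ⟨φ, hφ⟩ := LinearMap.exists_extend
      ((Basis.span he).constr ℂ (fun i => if i = j then (1 : ℂ) else 0))
    obtain ⟨f, hf⟩ := hsurj φ
    refine ⟨f, fun i => ?_⟩
    rw [hf]
    have h2 := LinearMap.congr_fun hφ (Basis.span he i)
    rw [Basis.constr_basis] at h2
    simpa [Basis.span_apply] using h2
  choose f' hf' using h1
  have hf'' : ∀ j i, ω (e i) (f' j) = if i = j then 1 else 0 := fun j i => by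
    rw [hsym, hf']
  let f : Fin n → V := fun j => f' j - (1 / 2 : ℂ) • ∑ i, ω (f' i) (f' j) • e i
  have hfe : ∀ j i, ω (f j) (e i) = if i = j then 1 else 0 := by
    intro j i
    simp [f, hf', hiso]
  have hef : ∀ j i, ω (e i) (f j) = if i = j then 1 else 0 := by
    intro j i
    rw [hsym, hfe]
  have hff : ∀ j i, ω (f j) (f i) = 0 := by
    intro j i
    have : ω (f j) (f i) = ω (f j) (f' i) - (1 / 2) * ∑ l, ω (f' l) (f' i) * ω (f j) (e l) := by
      conv_lhs => rw [show f i = f' i - (1 / 2 : ℂ) • ∑ l, ω (f' l) (f' i) • e l from rfl]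
      simp only [map_sub, map_smul, map_sum, smul_eq_mul]
    rw [this]
    simp only [hfe]
    simp [f, hf'']
    rw [hsym (f' i) (f' j)]
    ring
  let g : Fin n ⊕ Fin n → V := Sum.elim e f
  have hg : ∀ x y, ω (g x) (g y) = if x.swap = y then 1 else 0 := by
    rintro (x | x) (y | y) <;> simp [g, hiso, hff, hfe, hef, eq_comm]
  have hli : LinearIndependent ℂ g := by
    refine aux_li ω g (fun x => g x.swap) (fun _ => 1) (by simp) ?_
    intro x y
    rw [hg]
    simp [Sum.swap_leftInverse.injective.eq_iff]
  have : Nonempty (Fin n ⊕ Fin n) := ⟨Sum.inl ⟨0, hn⟩⟩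
  refine ⟨basisOfLinearIndependentOfCardEqFinrank hli (by simp [hdimV]; ring), ?_, ?_⟩
  · intro i; simp [g]
  · intro x y; simp [hg]

theorem aux_exists {V : Type*} [AddCommGroup V] [Module ℂ V] [FiniteDimensional ℂ V]
    (n : ℕ) (hdimV : finrank ℂ V = 2 * n)
    (ω : V →ₗ[ℂ] V →ₗ[ℂ] ℂ)
    (hnd : ∀ v, (∀ w, ω v w = 0) → v = 0)
    (hsym : ∀ v w, ω v w = ω w v) :
    ∃ e : Fin n → V, LinearIndependent ℂ e ∧ ∀ i j, ω (e i) (e j) = 0 := by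
  have : Invertible (2 : ℂ) := invertibleOfNonzero two_ne_zero
  obtain ⟨v, hv⟩ := LinearMap.BilinForm.exists_orthogonal_basis (B := ω) ⟨fun x y => hsym x y⟩
  have hne := LinearMap.IsOrthoᵢ.not_isOrtho_basis_self_of_separatingLeft hv hnd
  have hcard : Fintype.card (Fin (finrank ℂ V)) = Fintype.card (Fin n ⊕ Fin n) := by
    simp [hdimV]; ring
  let σ := (Fintype.equivOfCardEq hcard).symm
  have ho : ∀ x y, ω (v (σ x)) (v (σ y)) = if x = y then ω (v (σ x)) (v (σ x)) else 0 := by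
    intro x y
    split_ifs with h
    · rw [h]
    · exact hv (σ.injective.ne h)
  have hs : ∀ x, ∃ z : ℂ, z ≠ 0 ∧ z * z * ω (v (σ x)) (v (σ x)) = 1 := by
    intro x
    obtain ⟨z, hz⟩ := IsAlgClosed.exists_pow_nat_eq (ω (v (σ x)) (v (σ x)))⁻¹ (n := 2) (by norm_num)
    have := hne (σ x)
    refine ⟨z, ?_, ?_⟩
    · rintro rfl
      have := inv_ne_zero this
      simp at hz
      exact hne (σ x) hz.symm
    · rw [← pow_two, hz, inv_mul_cancel₀ this]
  choose z hz0 hz using hs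
  let u : Fin n ⊕ Fin n → V := fun x => z x • v (σ x)
  have hu : ∀ x y, ω (u x) (u y) = if x = y then 1 else 0 := by
    intro x y
    have : ω (u x) (u y) = z x * z y * ω (v (σ x)) (v (σ y)) := by simp [u]; ring
    rw [this, ho]
    split_ifs with h
    · subst h; exact hz x
    · simp
  let e : Fin n → V := fun i => u (Sum.inl i) + Complex.I • u (Sum.inr i)
  refine ⟨e, aux_li ω e (fun i => u (Sum.inl i)) (fun _ => 1) (by simp) ?_, ?_⟩
  · intro i j
    simp [e, hu]
  · intro i j
    simp [e, hu]
    split_ifs <;> simp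

theorem aux_gram {V : Type*} [AddCommGroup V] [Module ℂ V]
    (n : ℕ) (ω : V →ₗ[ℂ] V →ₗ[ℂ] ℂ) (b : Basis (Fin n ⊕ Fin n) ℂ V)
    (hb : ∀ x y, ω (b x) (b y) = if x.swap = y then 1 else 0)
    (g : V →ₗ[ℂ] V) (hg : ∀ v w, ω (g v) (g w) = ω v w) :
    (LinearMap.toMatrix b b g).transpose * Matrix.fromBlocks 0 1 1 0 * LinearMap.toMatrix b b g
      = Matrix.fromBlocks 0 1 1 0 := by
  have hJ : LinearMap.toMatrix₂ b b ω = Matrix.fromBlocks 0 1 1 0 := by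
    ext (i | i) (j | j) <;> simp [LinearMap.toMatrix₂_apply, hb, Matrix.one_apply]
  have hc : ω.compl₁₂ g g = ω := by
    ext v w; simp [hg]
  rw [← hJ, ← LinearMap.toMatrix₂_compl₁₂, hc]

theorem aux_det_sq {V : Type*} [AddCommGroup V] [Module ℂ V]
    (n : ℕ) (ω : V →ₗ[ℂ] V →ₗ[ℂ] ℂ) (b : Basis (Fin n ⊕ Fin n) ℂ V)
    (hb : ∀ x y, ω (b x) (b y) = if x.swap = y then 1 else 0)
    (g : V →ₗ[ℂ] V) (hg : ∀ v w, ω (g v) (g w) = ω v w) :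
    LinearMap.det g = 1 ∨ LinearMap.det g = -1 := by
  have h := aux_gram n ω b hb g hg
  set J : Matrix (Fin n ⊕ Fin n) (Fin n ⊕ Fin n) ℂ := Matrix.fromBlocks 0 1 1 0 with hJ
  have hJJ : J * J = 1 := by
    simp [hJ, Matrix.fromBlocks_multiply]
  have hJd : J.det ≠ 0 := by
    intro h0
    have := congrArg Matrix.det hJJ
    simp [h0] at this
  have h2 := congrArg Matrix.det h
  rw [Matrix.det_mul, Matrix.det_mul, Matrix.det_transpose, LinearMap.det_toMatrix] at h2
  apply eq_or_eq_neg_of_sq_eq_sq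
  rw [one_pow]
  apply mul_right_cancel₀ hJd
  linear_combination h2

theorem aux_det_one {V : Type*} [AddCommGroup V] [Module ℂ V]
    (n : ℕ) (ω : V →ₗ[ℂ] V →ₗ[ℂ] ℂ) (b : Basis (Fin n ⊕ Fin n) ℂ V)
    (hb : ∀ x y, ω (b x) (b y) = if x.swap = y then 1 else 0)
    (g : V →ₗ[ℂ] V) (hg : ∀ v w, ω (g v) (g w) = ω v w)
    (hL : ∀ i, g (b (Sum.inl i)) ∈ span ℂ (Set.range fun i => b (Sum.inl i))) :
    LinearMap.det g = 1 := by
  have h := aux_gram n ω b hb g hg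
  rw [← LinearMap.det_toMatrix b]
  set M := LinearMap.toMatrix b b g with hM
  have h21 : M.toBlocks₂₁ = 0 := by
    ext i j
    simp only [Matrix.toBlocks₂₁, Matrix.of_apply, Matrix.zero_apply, hM, LinearMap.toMatrix_apply]
    have : span ℂ (Set.range fun i => b (Sum.inl i)) ≤ LinearMap.ker (b.coord (Sum.inr i)) := by
      rw [span_le]
      rintro _ ⟨l, rfl⟩
      simp
    exact this (hL j)
  rw [← Matrix.fromBlocks_toBlocks M, h21] at h ⊢
  rw [Matrix.fromBlocks_transpose, Matrix.fromBlocks_multiply, Matrix.fromBlocks_multiply,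
    Matrix.fromBlocks_inj] at h
  have h12 := h.2.1
  simp at h12
  have := congrArg Matrix.det h12
  rw [Matrix.det_mul, Matrix.det_transpose, Matrix.det_one] at this
  rw [Matrix.det_fromBlocks_zero₂₁, this]

theorem aux_equiv {V : Type*} [AddCommGroup V] [Module ℂ V]
    (n : ℕ) (ω : V →ₗ[ℂ] V →ₗ[ℂ] ℂ) (b c : Basis (Fin n ⊕ Fin n) ℂ V)
    (hb : ∀ x y, ω (b x) (b y) = if x.swap = y then 1 else 0)
    (hc : ∀ x y, ω (c x) (c y) = if x.swap = y then 1 else 0)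
    (σ : Equiv.Perm (Fin n ⊕ Fin n)) (hσ : ∀ x, (σ x).swap = σ x.swap) (v w : V) :
    ω (b.equiv c σ v) (b.equiv c σ w) = ω v w := by
  have : ω.compl₁₂ (b.equiv c σ : V →ₗ[ℂ] V) (b.equiv c σ : V →ₗ[ℂ] V) = ω := by
    apply LinearMap.ext_basis b b
    intro x y
    simp [hb, hc, hσ]
  exact LinearMap.congr_fun (LinearMap.congr_fun this v) w

theorem aux_refl {V : Type*} [AddCommGroup V] [Module ℂ V]
    (n : ℕ) (hn : 1 ≤ n) (ω : V →ₗ[ℂ] V →ₗ[ℂ] ℂ) (b : Basis (Fin n ⊕ Fin n) ℂ V)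
    (hb : ∀ x y, ω (b x) (b y) = if x.swap = y then 1 else 0) :
    ∃ s : V ≃ₗ[ℂ] V, (∀ v w, ω (s v) (s w) = ω v w) ∧ LinearMap.det (s : V →ₗ[ℂ] V) = -1 := by
  let i0 : Fin n := ⟨0, hn⟩
  let σ : Equiv.Perm (Fin n ⊕ Fin n) := Equiv.swap (Sum.inl i0) (Sum.inr i0)
  refine ⟨b.equiv b σ, aux_equiv n ω b b hb hb σ ?_, ?_⟩
  · intro x
    simp only [σ, Equiv.swap_apply_def]
    rcases x with x | x <;> by_cases h : x = i0 <;> simp [h]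
  · rw [← LinearMap.det_toMatrix b]
    have : LinearMap.toMatrix b b (b.equiv b σ : V →ₗ[ℂ] V) = (σ.permMatrix ℂ) := by
      ext x y
      simp [LinearMap.toMatrix_apply, Equiv.Perm.permMatrix, PEquiv.toMatrix_apply,
        Finsupp.single_apply, σ]
      congr 1
      rw [eq_iff_iff, Equiv.swap_apply_eq_iff, eq_comm]
    rw [this, Matrix.det_permutation, Equiv.Perm.sign_swap (by simp)]
    simp

theorem aux_flag {V : Type*} [AddCommGroup V] [Module ℂ V] [FiniteDimensional ℂ V]
    (F : ℕ → Submodule ℂ V) (hF : Monotone F) (h0 : F 0 = ⊥) (p : ℕ) :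
    ∃ e : ℕ → V, ∀ q ≤ p, F q = span ℂ (e '' {i | i < finrank ℂ (F q)}) := by
  induction p with
  | zero =>
    refine ⟨fun _ => 0, fun q hq => ?_⟩
    obtain rfl : q = 0 := by omega
    rw [h0]; simp
  | succ p ih =>
    obtain ⟨e, he⟩ := ih
    have hle : F p ≤ F (p + 1) := hF (Nat.le_succ p)
    obtain ⟨C, hC1, hC2⟩ : ∃ C, F p ⊔ C = F (p+1) ∧ F p ⊓ C = ⊥ := by
      obtain ⟨D, hD⟩ := Submodule.exists_isCompl (F p)
      refine ⟨D ⊓ F (p+1), ?_, ?_⟩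
      · rw [← sup_inf_assoc_of_le _ hle, hD.sup_eq_top, top_inf_eq]
      · rw [← inf_assoc, hD.inf_eq_bot, bot_inf_eq]
    have hfr := finrank_sup_add_finrank_inf_eq (F p) C
    rw [hC1, hC2, finrank_bot, add_zero] at hfr
    let c := finBasis ℂ C
    let e' : ℕ → V := fun i => if i < finrank ℂ (F p) then e i else
      if h : i - finrank ℂ (F p) < finrank ℂ C then (c ⟨_, h⟩ : V) else 0
    have hee : ∀ i < finrank ℂ (F p), e' i = e i := fun i hi => by simp [e', hi]
    have hold : ∀ q ≤ p, F q = span ℂ (e' '' {i | i < finrank ℂ (F q)}) := by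
      intro q hq
      conv_lhs => rw [he q hq]
      congr 1
      apply Set.image_congr
      intro i hi
      exact (hee i (lt_of_lt_of_le hi (finrank_mono (hF hq)))).symm
    refine ⟨e', fun q hq => ?_⟩
    rcases Nat.lt_or_ge p q with h | h
    · obtain rfl : q = p + 1 := by omega
      have hCs : C = span ℂ (e' '' {i | finrank ℂ (F p) ≤ i ∧ i < finrank ℂ (F (p+1))}) := by
        have h1 : C = span ℂ (Set.range fun i => (c i : V)) := by
          have := congrArg (Submodule.map C.subtype) c.span_eq
          rw [Submodule.map_span, Submodule.map_top, range_subtype, ← Set.range_comp] at this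
          exact this.symm
        conv_lhs => rw [h1]
        congr 1
        ext x
        constructor
        · rintro ⟨i, rfl⟩
          refine ⟨finrank ℂ (F p) + i, ⟨by omega, by omega⟩, ?_⟩
          simp [e']
        · rintro ⟨i, ⟨hi1, hi2⟩, rfl⟩
          have : i - finrank ℂ (F p) < finrank ℂ C := by omega
          refine ⟨⟨_, this⟩, ?_⟩
          simp [e', this, not_lt.2 hi1]
      conv_lhs => rw [← hC1, hold p le_rfl, hCs, ← span_union, ← Set.image_union]
      congr 2
      ext i
      simp
      omega
    · exact hold q h

theorem aux_adapted {V : Type*} [AddCommGroup V] [Module ℂ V] [FiniteDimensional ℂ V]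
    (n : ℕ) (k : ℕ) (hk : 2 ≤ k)
    (d : Fin k → ℕ) (hd0 : d ⟨0, by omega⟩ = 0) (hdsm : StrictMono d)
    (hdlast : d ⟨k - 1, by omega⟩ = n) (W : Fin k → Submodule ℂ V) (hW : Monotone W)
    (hWd : ∀ p, finrank ℂ (W p) = d p) :
    ∃ e : Fin n → V, LinearIndependent ℂ e ∧ ∀ p, W p = span ℂ (e '' {i | i.val < d p}) := by
  let F : ℕ → Submodule ℂ V := fun q => W ⟨min q (k-1), by omega⟩
  have hF : Monotone F := by
    intro a b hab
    apply hW
    simp only [Fin.mk_le_mk]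
    omega
  have hF0 : F 0 = ⊥ := by
    apply Submodule.finrank_eq_zero.1
    simp [F, hWd, hd0]
  obtain ⟨e, he⟩ := aux_flag F hF hF0 (k-1)
  have hFW : ∀ p : Fin k, F p = W p := by
    intro p
    simp only [F]
    congr 1
    apply Fin.ext
    simp
    omega
  have hsp : ∀ p : Fin k, W p = span ℂ ((fun i : Fin n => e i) '' {i | i.val < d p}) := by
    intro p
    have h := he p (by omega)
    rw [hFW, hWd] at h
    conv_lhs => rw [h]
    congr 1
    have hdp : d p ≤ n := by
      rw [← hdlast]
      apply hdsm.monotone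
      rw [Fin.le_def]
      simp
      omega
    ext x
    constructor
    · rintro ⟨i, hi, rfl⟩
      exact ⟨⟨i, lt_of_lt_of_le hi hdp⟩, hi, rfl⟩
    · rintro ⟨i, hi, rfl⟩
      exact ⟨i, hi, rfl⟩
  refine ⟨fun i => e i, ?_, hsp⟩
  rw [linearIndependent_iff_card_eq_finrank_span, Set.finrank]
  have h := hsp ⟨k-1, by omega⟩
  rw [hdlast] at h
  have h2 : {i : Fin n | i.val < n} = Set.univ := by ext i; simp
  rw [h2, Set.image_univ] at h
  rw [← h, hWd, hdlast]
  simp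

/-- If `ω` is symmetric, `m = 2n`, and `d_{k−1} = n`, then the special
orthogonal group `SO(V,ω)` acts on the set of isotropic partial flags of type `d` with
exactly two orbits. -/
theorem stmt_5 (V : Type*) [AddCommGroup V] [Module ℂ V] [FiniteDimensional ℂ V]
    (n : ℕ) (hn : 1 ≤ n) (hdimV : finrank ℂ V = 2 * n)
    (ω : V →ₗ[ℂ] V →ₗ[ℂ] ℂ)
    (hnd : ∀ v, (∀ w, ω v w = 0) → v = 0)
    (hsym : ∀ v w, ω v w = ω w v)
    (k : ℕ) (hk : 2 ≤ k)
    (d : Fin k → ℕ) (hd0 : d ⟨0, by omega⟩ = 0) (hdsm : StrictMono d)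
    (hdlast : d ⟨k - 1, by omega⟩ = n) :
    ∃ F₁ F₂ : Fin k → Submodule ℂ V,
      (Monotone F₁ ∧ (∀ p, ∀ v ∈ F₁ p, ∀ w ∈ F₁ p, ω v w = 0) ∧
        ∀ p, finrank ℂ (F₁ p) = d p) ∧
      (Monotone F₂ ∧ (∀ p, ∀ v ∈ F₂ p, ∀ w ∈ F₂ p, ω v w = 0) ∧
        ∀ p, finrank ℂ (F₂ p) = d p) ∧
      (¬ ∃ g : V ≃ₗ[ℂ] V, (∀ v w, ω (g v) (g w) = ω v w) ∧
          LinearMap.det (g : V →ₗ[ℂ] V) = 1 ∧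
          ∀ p, (F₁ p).map (g : V →ₗ[ℂ] V) = F₂ p) ∧
      ∀ W : Fin k → Submodule ℂ V,
        Monotone W → (∀ p, ∀ v ∈ W p, ∀ w ∈ W p, ω v w = 0) →
        (∀ p, finrank ℂ (W p) = d p) →
        ((∃ g : V ≃ₗ[ℂ] V, (∀ v w, ω (g v) (g w) = ω v w) ∧
            LinearMap.det (g : V →ₗ[ℂ] V) = 1 ∧
            ∀ p, (F₁ p).map (g : V →ₗ[ℂ] V) = W p) ∨
         (∃ g : V ≃ₗ[ℂ] V, (∀ v w, ω (g v) (g w) = ω v w) ∧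
            LinearMap.det (g : V →ₗ[ℂ] V) = 1 ∧
            ∀ p, (F₂ p).map (g : V →ₗ[ℂ] V) = W p)) := by
  obtain ⟨e, hli, hiso⟩ := aux_exists n hdimV ω hnd hsym
  obtain ⟨b, hbe, hb⟩ := aux_hyp n hn hdimV ω hnd hsym e hli hiso
  obtain ⟨s, hs, hsd⟩ := aux_refl n hn ω b hb
  have huniv : {i : Fin n | i.val < d ⟨k - 1, by omega⟩} = Set.univ := by
    ext i; simp [hdlast]
  have hdn : ∀ p, d p ≤ n := by
    intro p
    rw [← hdlast]
    apply hdsm.monotone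
    rw [Fin.le_def]
    simp
    omega
  have hs' : ∀ v w, ω (s.symm v) (s.symm w) = ω v w := fun v w => by
    rw [← hs]; simp
  have hsd' : LinearMap.det (s.symm : V →ₗ[ℂ] V) = -1 := by
    have h1 := LinearEquiv.det_symm_mul_det s
    rw [hsd] at h1
    linear_combination -h1
  let F : Fin k → Submodule ℂ V := fun p => span ℂ (e '' {i | i.val < d p})
  have hFm : Monotone F := fun p q hpq => span_mono (Set.image_mono fun i hi =>
    lt_of_lt_of_le hi (hdsm.monotone hpq))
  have hFi : ∀ p, ∀ v ∈ F p, ∀ w ∈ F p, ω v w = 0 := by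
    intro p v hv w hw
    induction hv using span_induction with
    | zero => simp
    | add x y _ _ hx hy => simp [hx, hy]
    | smul a x _ hx => simp [hx]
    | mem x hx =>
      obtain ⟨i, _, rfl⟩ := hx
      induction hw using span_induction with
      | zero => simp
      | add x y _ _ hx hy => simp [hx, hy]
      | smul a x _ hx => simp [hx]
      | mem x hx =>
        obtain ⟨j, _, rfl⟩ := hx
        exact hiso i j
  have hFd : ∀ p, finrank ℂ (F p) = d p := by
    intro p
    have h1 := finrank_span_eq_card (R := ℂ) (b := fun i : {i : Fin n // i.val < d p} => e i)
      (hli.comp _ Subtype.val_injective)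
    have h2 : Set.range (fun i : {i : Fin n // i.val < d p} => e i) = e '' {i | i.val < d p} := by
      ext x; simp
    rw [h2] at h1
    rw [h1, Fintype.card_subtype]
    have := Fin.card_filter_val_lt (n := n) (m := d p)
    rw [this, min_eq_right (hdn p)]
  refine ⟨F, fun p => (F p).map (s : V →ₗ[ℂ] V), ⟨hFm, hFi, hFd⟩, ⟨?_, ?_, ?_⟩, ?_, ?_⟩
  · intro p q hpq
    exact Submodule.map_mono (hFm hpq)
  · rintro p _ ⟨v, hv, rfl⟩ _ ⟨w, hw, rfl⟩
    exact (hs v w).trans (hFi p v hv w hw)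
  · intro p
    rw [← hFd p]
    exact LinearEquiv.finrank_map_eq s (F p)
  · rintro ⟨g, hg, hgd, hgF⟩
    have h1 := aux_det_one n ω b hb ((s.symm : V →ₗ[ℂ] V) ∘ₗ (g : V →ₗ[ℂ] V))
      (fun v w => by simp [hs', hg]) ?_
    · rw [LinearMap.det_comp, hgd, hsd'] at h1
      norm_num at h1
    · intro i
      have h2 : span ℂ (Set.range fun i => b (Sum.inl i)) = F ⟨k-1, by omega⟩ := by
        simp only [F]
        rw [huniv, Set.image_univ]
        simp [hbe]
      rw [h2]
      have h3 : g (b (Sum.inl i)) ∈ (F ⟨k-1, by omega⟩).map (s : V →ₗ[ℂ] V) := by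
        refine (hgF _).le ?_
        refine ⟨_, ?_, rfl⟩
        rw [← h2]
        exact subset_span ⟨i, rfl⟩
      obtain ⟨x, hx, hxe⟩ := h3
      have : x = s.symm (g (b (Sum.inl i))) := by
        rw [← hxe]; simp
      simpa [← this] using hx
  · intro W hWm hWi hWd
    obtain ⟨e2, hli2, hW2⟩ := aux_adapted n k hk d hd0 hdsm hdlast W hWm hWd
    have hmem : ∀ i, e2 i ∈ W ⟨k-1, by omega⟩ := by
      intro i
      rw [hW2, huniv]
      exact subset_span ⟨i, trivial, rfl⟩
    obtain ⟨c, hce, hc⟩ := aux_hyp n hn hdimV ω hnd hsym e2 hli2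
      (fun i j => hWi _ _ (hmem i) _ (hmem j))
    let h := b.equiv c (Equiv.refl _)
    have hh : ∀ v w, ω (h v) (h w) = ω v w := aux_equiv n ω b c hb hc _ (by simp)
    have hhe : ∀ i, h (e i) = e2 i := by
      intro i
      rw [← hbe, ← hce]
      simp [h]
    have hhF : ∀ p, (F p).map (h : V →ₗ[ℂ] V) = W p := by
      intro p
      rw [hW2]
      simp only [F]
      rw [Submodule.map_span, Set.image_image]
      simp [hhe]
    rcases aux_det_sq n ω b hb (h : V →ₗ[ℂ] V) hh with hd | hd
    · exact Or.inl ⟨h, hh, hd, hhF⟩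
    · refine Or.inr ⟨s.symm.trans h, ?_, ?_, ?_⟩
      · intro v w
        simp [hh, hs']
      · rw [LinearEquiv.coe_trans, LinearMap.det_comp, hd, hsd']
        norm_num
      · intro p
        rw [← hhF p, ← Submodule.map_comp]
        congr 1
        ext v
        simp
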